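/- Let K be an algebraically closed field of characteristic zero and n ≥ 3. Then each of the quartics F_5 = x_0x_1(x_1x_2+x_3^2+⋯+x_n^2), F_7 = x_0(x_0+x_1)(x_1^2+⋯+x_n^2), F_{8,λ} = x_0(λx_0+x_1)(x_0^2+⋯+x_n^2) for λ ∈ K with λ ≠ 0, F_9 = x_0x_1(x_0^2+x_1x_2+x_3^2+⋯+x_n^2), and F_{10,λ} = x_0(−λ^2x_0+x_1+λx_2)(x_0x_1+x_2^2+⋯+x_n^2) for λ ∈ K, in K[x_0,...,x_n], satisfies 4(n−1) ≤ rk(F) ≤ 4(n−1) + 2. -/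

import Mathlib

open MvPolynomial

/-- Apply the iterated partial-derivative operator `∏ i, (∂/∂xᵢ)^(d i)` to `F`. -/
noncomputable def diffOp {K : Type*} [CommSemiring K] {m : ℕ} (d : Fin m →₀ ℕ)
    (F : MvPolynomial (Fin m) K) : MvPolynomial (Fin m) K :=
  (List.finRange m).foldr (fun i G => (⇑(MvPolynomial.pderiv i))^[d i] G) F

/-- Apolarity action: apply the differential polynomial `δ` (in the dual variables)
to the polynomial `F`. -/
noncomputable def applyDiff {K : Type*} [CommSemiring K] {m : ℕ}
    (δ F : MvPolynomial (Fin m) K) : MvPolynomial (Fin m) K :=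
  δ.support.sum fun d => δ.coeff d • diffOp d F

/-- `IsWaringDecomp F d r`: the degree-`d` form `F` lies in the linear span of the
`d`-th powers of `r` linear forms. -/
def IsWaringDecomp {K : Type*} [Field K] {m : ℕ} (F : MvPolynomial (Fin m) K)
    (d r : ℕ) : Prop :=
  ∃ ℓ : Fin r → MvPolynomial (Fin m) K,
    (∀ j, (ℓ j).IsHomogeneous 1) ∧
    F ∈ Submodule.span K (Set.range fun j => ℓ j ^ d)

/-- The symmetric (Waring) rank of a degree-`d` form. -/
noncomputable def waringRank {K : Type*} [Field K] {m : ℕ}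
    (F : MvPolynomial (Fin m) K) (d : ℕ) : ℕ :=
  sInf {r | IsWaringDecomp F d r}

/-- `∑_{i ≥ t} x_i²`. -/
noncomputable def sumSqFrom (K : Type*) [CommSemiring K] (m t : ℕ) :
    MvPolynomial (Fin m) K :=
  ∑ i ∈ Finset.univ.filter (fun i : Fin m => t ≤ (i : ℕ)), X i ^ 2

theorem map_mul_linearCombination_mul {K A κ : Type*} [Field K] [CommRing A] [Algebra K A]
    [Fintype κ] (φ : A →ₗ[K] K) (y : κ → A) (a : A) (v : κ → K) (z : A) :
    φ (a * (Fintype.linearCombination K y v * z)) = ∑ i, v i * φ (a * (y i * z)) := by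
  simp [Fintype.linearCombination_apply, Finset.sum_mul, Finset.mul_sum]

section Apolar

variable {K A ι κ : Type*} [Field K] [CharZero K] [CommRing A] [Algebra K A] [Module.Finite K A]
  [Fintype κ] [DecidableEq κ]

theorem four_mul_card_le_finrank (φ : A →ₗ[K] K) (Y : ι → A) (e : κ → ι) (i0 i1 : ι)
    (hone : ∃ τ : κ → K, Fintype.linearCombination K (Y ∘ e) τ = 1)
    (h01 : ∀ i j, φ (Y (e i) * (Y (e j) * (Y i0 * Y i1))) = if i = j then 2 else 0)
    (h11 : ∀ i j, φ (Y (e i) * (Y (e j) * (Y i1 * Y i1))) = 0)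
    (h3 : ∀ i j k a, φ (Y (e i) * (Y (e j) * (Y (e k) * Y a))) = 0) :
    4 * Fintype.card κ ≤ Module.finrank K A := by
  obtain ⟨τ, hτ⟩ := hone
  set L := Fintype.linearCombination K (Y ∘ e) with hL
  have one (z : A) : φ z = ∑ k, τ k * φ (Y (e k) * z) := by
    simpa [← hL, hτ] using map_mul_linearCombination_mul φ (Y ∘ e) 1 τ z
  have key (p : κ → K) (z : A) : φ (L p * z) = ∑ k, p k * φ (Y (e k) * z) := by
    simpa [← hL] using map_mul_linearCombination_mul φ (Y ∘ e) 1 p z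
  have h2 (i j a) : φ (Y (e i) * (Y (e j) * Y a)) = 0 := by rw [one]; simp [h3]
  have h1 (i j) : φ (Y (e i) * Y (e j)) = 0 := by rw [one]; simp [h2]
  let T : ((κ → K) × (κ → K)) × ((κ → K) × (κ → K)) →ₗ[K] A :=
    (L.coprod (LinearMap.mulLeft K (Y i0) ∘ₗ L)).coprod
      ((LinearMap.mulLeft K (Y i1) ∘ₗ L).coprod (LinearMap.mulLeft K (Y i0 * Y i1) ∘ₗ L))
  have hT : Function.Injective T := by
    rw [← LinearMap.ker_eq_bot, LinearMap.ker_eq_bot']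
    rintro ⟨⟨p, q⟩, r, s⟩ hf
    simp only [T, LinearMap.coprod_apply, LinearMap.comp_apply, LinearMap.mulLeft_apply] at hf
    have hs : s = 0 := by
      ext i
      have e : L p * Y (e i) + L q * (Y (e i) * Y i0) + L r * (Y (e i) * Y i1) +
          L s * (Y (e i) * (Y i0 * Y i1)) = 0 := by
        linear_combination Y (e i) * hf
      simpa [key, h1, h2, h01] using congrArg φ e
    subst hs
    have hq : q = 0 := by
      ext i
      have e : L p * (Y (e i) * Y i1) + L q * (Y (e i) * (Y i0 * Y i1)) +
          L r * (Y (e i) * (Y i1 * Y i1)) = 0 := by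
        rw [map_zero] at hf; linear_combination Y (e i) * Y i1 * hf
      simpa [key, h2, h01, h11] using congrArg φ e
    subst hq
    have hr : r = 0 := by
      ext i
      have e : L p * (Y (e i) * Y i0) + L r * (Y (e i) * (Y i0 * Y i1)) = 0 := by
        simp only [map_zero] at hf; linear_combination Y (e i) * Y i0 * hf
      simpa [key, h2, h01] using congrArg φ e
    subst hr
    have hp : p = 0 := by
      ext i
      have e : L p * (Y (e i) * (Y i0 * Y i1)) = 0 := by
        simp only [map_zero] at hf; linear_combination Y (e i) * Y i0 * Y i1 * hf
      simpa [key, h01] using congrArg φ e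
    simp [hp]
  have := LinearMap.finrank_le_finrank_of_injective hT
  simp only [Module.finrank_prod, Module.finrank_fintype_fun_eq_card] at this
  omega

theorem four_mul_card_add_four_le_finrank (φ : A →ₗ[K] K) (Y : ι → A) (e : κ → ι) (i0 i1 i2 : ι)
    (hone : ∃ (τ : κ → K) (σ : K), Fintype.linearCombination K (Y ∘ e) τ + σ • Y i2 = 1)
    (h01 : ∀ i j, φ (Y (e i) * (Y (e j) * (Y i0 * Y i1))) = if i = j then 2 else 0)
    (h11 : ∀ i j, φ (Y (e i) * (Y (e j) * (Y i1 * Y i1))) = 0)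
    (h3 : ∀ i j k a, φ (Y (e i) * (Y (e j) * (Y (e k) * Y a))) = 0)
    (h011 : ∀ i, φ (Y (e i) * (Y i0 * (Y i1 * Y i1))) = 0)
    (h111 : ∀ i, φ (Y (e i) * (Y i1 * (Y i1 * Y i1))) = 0)
    (h2011 : φ (Y i2 * (Y i0 * (Y i1 * Y i1))) = 2)
    (h2i : ∀ i a b, φ (Y i2 * (Y (e i) * (Y a * Y b))) = 0)
    (h22 : ∀ a b, φ (Y i2 * (Y i2 * (Y a * Y b))) = 0) :
    4 * Fintype.card κ + 4 ≤ Module.finrank K A := by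
  obtain ⟨τ, σ, hτ⟩ := hone
  set L := Fintype.linearCombination K (Y ∘ e) with hL
  have key' (a : A) (p : κ → K) (z : A) :
      φ (a * (L p * z)) = ∑ k, p k * φ (a * (Y (e k) * z)) :=
    map_mul_linearCombination_mul φ (Y ∘ e) a p z
  have key (p : κ → K) (z : A) : φ (L p * z) = ∑ k, p k * φ (Y (e k) * z) := by
    simpa using key' 1 p z
  have one (z : A) : φ z = ∑ k, τ k * φ (Y (e k) * z) + σ * φ (Y i2 * z) := by
    conv_lhs => rw [← one_mul z, ← hτ, add_mul, map_add, key]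
    simp
  have comm (i z) : Y (e i) * (Y i2 * z) = Y i2 * (Y (e i) * z) := by ring
  have a1 (i j a) : φ (Y (e i) * (Y (e j) * Y a)) = 0 := by rw [one]; simp [h3, h2i]
  have c1 (a) : φ (Y i2 * (Y i2 * Y a)) = 0 := by rw [one]; simp [comm, h22]
  have b1 (i a) : φ (Y i2 * (Y (e i) * Y a)) = 0 := by rw [one]; simp [comm, h2i, h22]
  have b2 (i) : φ (Y i2 * Y (e i)) = 0 := by rw [one]; simp [comm, b1, c1]
  have b2' (i) : φ (Y (e i) * Y i2) = 0 := by rw [mul_comm, b2]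
  have a2 (i j) : φ (Y (e i) * Y (e j)) = 0 := by rw [one]; simp [a1, b1]
  have c2 : φ (Y i2 * Y i2) = 0 := by rw [one]; simp [comm, b1, c1]
  have d1 (i) : φ (Y (e i) * (Y i1 * Y i1)) = 0 := by rw [one]; simp [h11, h2i]
  have d2 : φ (Y i2 * (Y i1 * Y i1)) = 0 := by rw [one]; simp [comm, h2i, h22]
  let T : (((κ → K) × (κ → K)) × ((κ → K) × (κ → K))) × (K × K × K) →ₗ[K] A :=
    ((L.coprod (LinearMap.mulLeft K (Y i0) ∘ₗ L)).coprod
      ((LinearMap.mulLeft K (Y i1) ∘ₗ L).coprod (LinearMap.mulLeft K (Y i0 * Y i1) ∘ₗ L))).coprod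
    ((LinearMap.toSpanSingleton K A (Y i2)).coprod
      ((LinearMap.toSpanSingleton K A (Y i1 * Y i1)).coprod
        (LinearMap.toSpanSingleton K A (Y i0 * (Y i1 * Y i1)))))
  have reduce (p q r s : κ → K) (b c d ε₀ ε₁ : K)
      (hf : T (((p, q), (r, s)), (b, c, d)) = ε₀ • (Y i2 * Y i0) + ε₁ • (Y i2 * Y i1)) :
      q = 0 ∧ r = 0 ∧ s = 0 ∧ c = 0 ∧ d = 0 ∧
        L p + b • Y i2 = ε₀ • (Y i2 * Y i0) + ε₁ • (Y i2 * Y i1) := by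
    simp only [T, LinearMap.coprod_apply, LinearMap.comp_apply, LinearMap.mulLeft_apply,
      LinearMap.toSpanSingleton_apply, Algebra.smul_def] at hf
    have hs : s = 0 := by
      ext i
      have e : L p * Y (e i) + L q * (Y (e i) * Y i0) + L r * (Y (e i) * Y i1) +
          L s * (Y (e i) * (Y i0 * Y i1)) + b • (Y i2 * Y (e i)) + c • (Y (e i) * (Y i1 * Y i1)) +
          d • (Y (e i) * (Y i0 * (Y i1 * Y i1))) = ε₀ • (Y i2 * (Y (e i) * Y i0)) +
          ε₁ • (Y i2 * (Y (e i) * Y i1)) := by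
        simp only [Algebra.smul_def]
        linear_combination Y (e i) * hf
      simpa [key, a1, a2, b1, b2, d1, h011, h01] using congrArg φ e
    subst hs
    have hd : d = 0 := by
      have e : L p * Y i2 + L q * (Y i2 * Y i0) + L r * (Y i2 * Y i1) + b • (Y i2 * Y i2) +
          c • (Y i2 * (Y i1 * Y i1)) + d • (Y i2 * (Y i0 * (Y i1 * Y i1))) =
          ε₀ • (Y i2 * (Y i2 * Y i0)) + ε₁ • (Y i2 * (Y i2 * Y i1)) := by
        simp only [Algebra.smul_def]
        rw [map_zero] at hf
        linear_combination Y i2 * hf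
      simpa [key, comm, b1, b2', c1, c2, d2, h2011] using congrArg φ e
    subst hd
    have hq : q = 0 := by
      ext i
      have e : L p * (Y (e i) * Y i1) + L q * (Y (e i) * (Y i0 * Y i1)) +
          L r * (Y (e i) * (Y i1 * Y i1)) + b • (Y i2 * (Y (e i) * Y i1)) +
          c • (Y (e i) * (Y i1 * (Y i1 * Y i1))) =
          ε₀ • (Y i2 * (Y (e i) * (Y i0 * Y i1))) + ε₁ • (Y i2 * (Y (e i) * (Y i1 * Y i1))) := by
        simp only [Algebra.smul_def]
        simp only [map_zero] at hf
        linear_combination Y (e i) * Y i1 * hf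
      simpa [key, a1, b1, h01, h11, h111, h2i] using congrArg φ e
    subst hq
    have hr : r = 0 := by
      ext i
      have e : L p * (Y (e i) * Y i0) + L r * (Y (e i) * (Y i0 * Y i1)) +
          b • (Y i2 * (Y (e i) * Y i0)) + c • (Y (e i) * (Y i0 * (Y i1 * Y i1))) =
          ε₀ • (Y i2 * (Y (e i) * (Y i0 * Y i0))) + ε₁ • (Y i2 * (Y (e i) * (Y i0 * Y i1))) := by
        simp only [Algebra.smul_def]
        simp only [map_zero] at hf
        linear_combination Y (e i) * Y i0 * hf
      simpa [key, a1, b1, h01, h011, h2i] using congrArg φ e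
    subst hr
    have hc : c = 0 := by
      have e : L p * (Y i2 * Y i0) + b • (Y i2 * (Y i2 * Y i0)) +
          c • (Y i2 * (Y i0 * (Y i1 * Y i1))) =
          ε₀ • (Y i2 * (Y i2 * (Y i0 * Y i0))) + ε₁ • (Y i2 * (Y i2 * (Y i0 * Y i1))) := by
        simp only [Algebra.smul_def]
        simp only [map_zero] at hf
        linear_combination Y i2 * Y i0 * hf
      simpa [key, comm, b1, c1, h2011, h22] using congrArg φ e
    subst hc
    refine ⟨rfl, rfl, rfl, rfl, rfl, ?_⟩
    simp only [Algebra.smul_def]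
    simp only [map_zero] at hf
    linear_combination hf
  have hT : Function.Injective T := by
    rw [← LinearMap.ker_eq_bot, LinearMap.ker_eq_bot']
    rintro ⟨⟨⟨p, q⟩, r, s⟩, b, c, d⟩ hf
    obtain ⟨rfl, rfl, rfl, rfl, rfl, hf'⟩ := reduce p q r s b c d 0 0 (by simpa using hf)
    simp only [Algebra.smul_def, map_zero, zero_mul, add_zero] at hf'
    have hp : p = 0 := by
      ext i
      have e : L p * (Y (e i) * (Y i0 * Y i1)) + b • (Y i2 * (Y (e i) * (Y i0 * Y i1))) = 0 := by
        simp only [Algebra.smul_def]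
        linear_combination Y (e i) * Y i0 * Y i1 * hf'
      simpa [key, h01, h2i] using congrArg φ e
    subst hp
    have hb : b = 0 := by
      have e : b • (Y i2 * (Y i0 * (Y i1 * Y i1))) = 0 := by
        simp only [Algebra.smul_def]
        rw [map_zero] at hf'
        linear_combination Y i0 * Y i1 * Y i1 * hf'
      simpa [h2011] using congrArg φ e
    simp [hb]
  have hle := LinearMap.finrank_le_finrank_of_injective hT
  have hdom : Module.finrank K ((((κ → K) × (κ → K)) × ((κ → K) × (κ → K))) × (K × K × K)) =
      4 * Fintype.card κ + 3 := by
    simp only [Module.finrank_prod, Module.finrank_fintype_fun_eq_card, Module.finrank_self]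
    omega
  rw [hdom] at hle
  by_contra hlt
  have hsurj : Function.Surjective T :=
    (LinearMap.injective_iff_surjective_of_finrank_eq_finrank (by omega)).1 hT
  obtain ⟨⟨⟨⟨p, q⟩, r, s⟩, b, c, d⟩, h₀⟩ := hsurj (Y i2 * Y i0)
  obtain ⟨⟨⟨⟨p', q'⟩, r', s'⟩, b', c', d'⟩, h₁⟩ := hsurj (Y i2 * Y i1)
  obtain ⟨rfl, rfl, rfl, rfl, rfl, h₀'⟩ := reduce p q r s b c d 1 0 (by simpa using h₀)
  obtain ⟨rfl, rfl, rfl, rfl, rfl, h₁'⟩ := reduce p' q' r' s' b' c' d' 0 1 (by simpa using h₁)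
  simp only [Algebra.smul_def, map_zero, map_one, zero_mul, one_mul, zero_add, add_zero] at h₀' h₁'
  have hp' : p' = 0 := by
    have := reduce (b' • p - b • p') (p') (-p) 0 0 0 0 0 0 (by
      simp only [T, LinearMap.coprod_apply, LinearMap.comp_apply, LinearMap.mulLeft_apply,
        map_sub, map_smul, map_neg, map_zero]
      simp only [Algebra.smul_def, map_zero]
      linear_combination Y i0 * h₁' - Y i1 * h₀' + algebraMap K A b' * h₀' - algebraMap K A b * h₁')
    exact this.1
  subst hp'
  have e : b' • (Y i2 * (Y i0 * Y i1)) = Y i2 * (Y i0 * (Y i1 * Y i1)) := by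
    simp only [Algebra.smul_def]
    rw [map_zero] at h₁'
    linear_combination Y i0 * Y i1 * h₁'
  have h201 : φ (Y i2 * (Y i0 * Y i1)) = 0 := by rw [one]; simp [comm, h2i, h22]
  have := congrArg φ e
  simp [h201, h2011] at this

end Apolar

@[simp]
theorem pderiv_ofNat {K σ : Type*} [CommSemiring K] (i : σ) (N : ℕ) [N.AtLeastTwo] :
    pderiv i (ofNat(N) : MvPolynomial σ K) = 0 := by
  rw [← Nat.cast_ofNat, Derivation.map_natCast]

theorem IsWaringDecomp.exists_moments {K : Type*} [Field K] [CharZero K] {m r : ℕ}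
    {F : MvPolynomial (Fin m) K} (hF : IsWaringDecomp F 4 r) :
    ∃ (w : Fin r → K) (a : Fin r → Fin m → K), ∀ i j k l,
      pderiv l (pderiv k (pderiv j (pderiv i F))) =
        C (∑ p, w p * (a p i * (a p j * (a p k * a p l)))) := by
  obtain ⟨ℓ, hℓ, hF⟩ := hF
  obtain ⟨c, rfl⟩ := (Submodule.mem_span_range_iff_exists_fun K).1 hF
  have hd (p i) : ∃ b, pderiv i (ℓ p) = C b := by
    have := (hℓ p).pderiv (i := i)
    rw [Nat.sub_self, ← totalDegree_zero_iff_isHomogeneous, totalDegree_eq_zero_iff_eq_C] at this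
    exact ⟨_, this⟩
  choose a ha using hd
  refine ⟨fun p => 24 * c p, a, fun i j k l => ?_⟩
  simp only [map_sum]
  refine Finset.sum_congr rfl fun p _ => ?_
  rw [Derivation.map_smul, Derivation.map_smul, Derivation.map_smul, Derivation.map_smul,
    MvPolynomial.smul_eq_C_mul]
  have h24 : (C 24 : MvPolynomial (Fin m) K) = 24 := map_ofNat C 24
  simp [ha, h24]
  ring

theorem exists_normalized_functional {K ι κ : Type*} [Field K] [Infinite K] [Fintype κ] {r : ℕ}
    (w : Fin r → K) (a : Fin r → ι → K) (e : κ → ι) :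
    ∃ (s : Finset (Fin r)) (Y : ι → s → K) (φ : (s → K) →ₗ[K] K) (τ : κ → K),
      Fintype.linearCombination K (Y ∘ e) τ = 1 ∧
      ∀ i j k l, φ (Y (e i) * (Y j * (Y k * Y l))) =
        ∑ p, w p * (a p (e i) * (a p j * (a p k * a p l))) := by
  classical
  let s : Finset (Fin r) := {p | a p ∘ e ≠ 0}
  obtain ⟨f, hf⟩ := Module.exists_dual_forall_apply_ne_zero (K := K) (fun p : s => a p ∘ e)
    (fun p => (Finset.mem_filter.1 p.2).2)
  refine ⟨s, fun i p => a p i / f (a p ∘ e),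
    ∑ p : s, (w p * f (a p ∘ e) ^ 4) • LinearMap.proj p, fun i => f (Pi.single i 1), ?_, ?_⟩
  · ext p
    have h : f (a p ∘ e) = ∑ i, a p (e i) * f (Pi.single i 1) := by
      conv_lhs => rw [pi_eq_sum_univ' (a p ∘ e), map_sum]
      simp
    simp only [Fintype.linearCombination_apply, Finset.sum_apply, Pi.smul_apply, Function.comp_apply,
      smul_eq_mul, Pi.one_apply]
    refine Eq.trans ?_ (div_self (hf p))
    rw [eq_div_iff (hf p), Finset.sum_mul, h]
    refine Finset.sum_congr rfl fun i _ => ?_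
    have := hf p
    rw [← h]
    field_simp
  · intro i j k l
    rw [← Finset.sum_subset (Finset.subset_univ s), ← Finset.sum_coe_sort s]
    · simp only [LinearMap.sum_apply, LinearMap.smul_apply, LinearMap.proj_apply, Pi.mul_apply,
        smul_eq_mul]
      refine Finset.sum_congr rfl fun p _ => ?_
      have := hf p
      field_simp
    · intro p _ hp
      have : a p ∘ e = 0 := by simpa [s] using hp
      simp [show a p (e i) = 0 from congrFun this i]

theorem IsWaringDecomp.le_of_mul_sumSq {K : Type*} [Field K] [CharZero K] {k r : ℕ} {a b c : K}
    (h : IsWaringDecomp (X 0 * X 1 * (C a * X 0 ^ 2 + C b * X 0 * X 1 + C c * X 1 ^ 2 +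
      ∑ i : Fin (k + 2), X i.succ.succ ^ 2) : MvPolynomial (Fin (k + 4)) K) 4 r) :
    4 * (k + 2) ≤ r := by
  obtain ⟨w, p, hp⟩ := h.exists_moments
  have h1 (j : Fin (k + 2)) : (1 : Fin (k + 4)) ≠ j.succ.succ := (Fin.succ_succ_ne_one j).symm
  have hpd (i : Fin (k + 2)) : pderiv i.succ.succ (X 0 * X 1 * (C a * X 0 ^ 2 + C b * X 0 * X 1 +
      C c * X 1 ^ 2 + ∑ i : Fin (k + 2), X i.succ.succ ^ 2) : MvPolynomial (Fin (k + 4)) K) =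
      2 * (X 0 * (X 1 * X i.succ.succ)) := by
    simp [pderiv_X, Pi.single_apply, h1]
    ring
  obtain ⟨s, Y, φ, τ, hτ, hφ⟩ :=
    exists_normalized_functional w p (fun i : Fin (k + 2) => i.succ.succ)
  have hval (i : Fin (k + 2)) (j l m) (v : K) (hv : pderiv m (pderiv l (pderiv j
      (2 * (X 0 * (X 1 * X i.succ.succ)) : MvPolynomial (Fin (k + 4)) K))) = C v) :
      φ (Y i.succ.succ * (Y j * (Y l * Y m))) = v := by
    apply C_injective (Fin (k + 4)) K
    rw [hφ, ← hp, hpd, hv]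
  have := four_mul_card_le_finrank φ Y (fun i : Fin (k + 2) => i.succ.succ) 0 1 ⟨τ, hτ⟩ ?_ ?_ ?_
  · rw [Module.finrank_fintype_fun_eq_card, Fintype.card_fin, Fintype.card_coe] at this
    exact this.trans (by simpa using Finset.card_le_univ s)
  · intro i j
    apply hval
    by_cases hij : i = j <;> simp [pderiv_X, h1, hij, map_ofNat C 2]
  · intro i j
    apply hval
    by_cases hij : i = j <;> simp [pderiv_X, h1, hij]
  · intro i j l m
    apply hval
    by_cases hij : i = j <;> simp [pderiv_X, h1, hij]

theorem IsWaringDecomp.le_of_tangent {K : Type*} [Field K] [CharZero K] {k r : ℕ} {e : K}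
    (h : IsWaringDecomp (X 0 * X 1 * (C e * X 0 ^ 2 + X 1 * X 2 +
      ∑ i : Fin (k + 1), X i.succ.succ.succ ^ 2) : MvPolynomial (Fin (k + 4)) K) 4 r) :
    4 * (k + 2) ≤ r := by
  obtain ⟨w, p, hp⟩ := h.exists_moments
  have h1 (j : Fin (k + 1)) : (1 : Fin (k + 4)) ≠ j.succ.succ.succ :=
    (Fin.succ_succ_ne_one j.succ).symm
  have h2 (j : Fin (k + 1)) : (2 : Fin (k + 4)) ≠ j.succ.succ.succ := by
    rw [Ne, Fin.ext_iff, Fin.val_two]; simp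
  have h3 : (0 : Fin (k + 4)) ≠ 2 := by rw [Ne, Fin.ext_iff, Fin.val_two]; simp
  have h4 : (1 : Fin (k + 4)) ≠ 2 := by rw [Ne, Fin.ext_iff, Fin.val_two]; simp
  have hpd (i : Fin (k + 1)) : pderiv i.succ.succ.succ (X 0 * X 1 * (C e * X 0 ^ 2 + X 1 * X 2 +
      ∑ i : Fin (k + 1), X i.succ.succ.succ ^ 2) : MvPolynomial (Fin (k + 4)) K) =
      2 * (X 0 * (X 1 * X i.succ.succ.succ)) := by
    simp [pderiv_X, Pi.single_apply, h1, h2]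
    ring
  have hpd2 : pderiv 2 (X 0 * X 1 * (C e * X 0 ^ 2 + X 1 * X 2 +
      ∑ i : Fin (k + 1), X i.succ.succ.succ ^ 2) : MvPolynomial (Fin (k + 4)) K) =
      X 0 * (X 1 * X 1) := by
    simp [pderiv_X, (h2 _).symm, h3, h4]
    ring
  obtain ⟨s, Y, φ, τ, hτ, hφ⟩ := exists_normalized_functional w p
    (fun i : Option (Fin (k + 1)) => i.elim 2 fun i => i.succ.succ.succ)
  have hval (i : Fin (k + 1)) (j l m) (v : K) (hv : pderiv m (pderiv l (pderiv j
      (2 * (X 0 * (X 1 * X i.succ.succ.succ)) : MvPolynomial (Fin (k + 4)) K))) = C v) :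
      φ (Y i.succ.succ.succ * (Y j * (Y l * Y m))) = v := by
    apply C_injective (Fin (k + 4)) K
    have := hφ (some i) j l m
    simp only [Option.elim_some] at this
    rw [this, ← hp, hpd, hv]
  have hval2 (j l m) (v : K) (hv : pderiv m (pderiv l (pderiv j
      (X 0 * (X 1 * X 1) : MvPolynomial (Fin (k + 4)) K))) = C v) :
      φ (Y 2 * (Y j * (Y l * Y m))) = v := by
    apply C_injective (Fin (k + 4)) K
    have := hφ none j l m
    simp only [Option.elim_none] at this
    rw [this, ← hp, hpd2, hv]
  have := four_mul_card_add_four_le_finrank φ Y (fun i : Fin (k + 1) => i.succ.succ.succ) 0 1 2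
    ⟨fun i => τ (some i), τ none, ?_⟩ ?_ ?_ ?_ ?_ ?_ ?_ ?_ ?_
  · rw [Module.finrank_fintype_fun_eq_card, Fintype.card_fin, Fintype.card_coe] at this
    exact this.trans (by simpa using Finset.card_le_univ s)
  · rw [← hτ, Fintype.linearCombination_apply, Fintype.linearCombination_apply,
      Fintype.sum_option, add_comm]
    rfl
  · intro i j
    apply hval
    by_cases hij : i = j <;> simp [pderiv_X, h1, hij, map_ofNat C 2]
  · intro i j
    apply hval
    by_cases hij : i = j <;> simp [pderiv_X, h1, hij]
  · intro i j l m
    apply hval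
    by_cases hij : i = j <;> simp [pderiv_X, h1, hij]
  · intro i
    apply hval
    simp [pderiv_X, (h1 _).symm]
  · intro i
    apply hval
    simp [pderiv_X, (h1 _).symm]
  · apply hval2
    simp [pderiv_X, map_ofNat C 2]
    norm_num
  · intro i j l
    apply hval2
    simp [pderiv_X, h1]
  · intro j l
    apply hval2
    simp [pderiv_X, h3, h4]

section Decomp

variable {K : Type*} [Field K] {m d r : ℕ} {F G : MvPolynomial (Fin m) K}

theorem isWaringDecomp_iff_exists_sum : IsWaringDecomp F d r ↔
    ∃ (c : Fin r → K) (ℓ : Fin r → MvPolynomial (Fin m) K),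
      (∀ j, (ℓ j).IsHomogeneous 1) ∧ F = ∑ j, C (c j) * ℓ j ^ d := by
  simp only [IsWaringDecomp, Submodule.mem_span_range_iff_exists_fun, smul_eq_C_mul]
  constructor
  · rintro ⟨ℓ, hℓ, c, h⟩
    exact ⟨c, ℓ, hℓ, h.symm⟩
  · rintro ⟨c, ℓ, hℓ, h⟩
    exact ⟨ℓ, hℓ, c, h.symm⟩

theorem isWaringDecomp_of_eq_sum {ι : Type*} [Fintype ι] (c : ι → K)
    (ℓ : ι → MvPolynomial (Fin m) K) (hℓ : ∀ j, (ℓ j).IsHomogeneous 1)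
    (hF : F = ∑ j, C (c j) * ℓ j ^ d) : IsWaringDecomp F d (Fintype.card ι) :=
  isWaringDecomp_iff_exists_sum.2 ⟨c ∘ (Fintype.equivFin ι).symm, ℓ ∘ (Fintype.equivFin ι).symm,
    fun _ => hℓ _, hF.trans <| ((Fintype.equivFin ι).symm.sum_comp
      fun j => C (c j) * ℓ j ^ d).symm⟩

theorem IsWaringDecomp.aeval {m' : ℕ} (hF : IsWaringDecomp F d r)
    {g : Fin m → MvPolynomial (Fin m') K} (hg : ∀ i, (g i).IsHomogeneous 1) :
    IsWaringDecomp (MvPolynomial.aeval g F) d r := by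
  obtain ⟨c, ℓ, hℓ, rfl⟩ := isWaringDecomp_iff_exists_sum.1 hF
  refine isWaringDecomp_iff_exists_sum.2 ⟨c, fun j => MvPolynomial.aeval g (ℓ j), fun j => ?_, ?_⟩
  · simpa using (hℓ j).aeval g hg
  · simp [algebraMap_eq]

theorem IsWaringDecomp.of_C_mul {u : K} (hu : u ≠ 0) (h : IsWaringDecomp (C u * F) d r) :
    IsWaringDecomp F d r := by
  obtain ⟨ℓ, hℓ, h⟩ := h
  refine ⟨ℓ, hℓ, ?_⟩
  rwa [← smul_eq_C_mul, Submodule.smul_mem_iff _ hu] at h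

theorem IsWaringDecomp.add {s : ℕ} (hF : IsWaringDecomp F d r) (hG : IsWaringDecomp G d s) :
    IsWaringDecomp (F + G) d (r + s) := by
  obtain ⟨c, ℓ, hℓ, rfl⟩ := isWaringDecomp_iff_exists_sum.1 hF
  obtain ⟨c', ℓ', hℓ', rfl⟩ := isWaringDecomp_iff_exists_sum.1 hG
  simpa using isWaringDecomp_of_eq_sum (d := d) (Sum.elim c c') (Sum.elim ℓ ℓ')
    (by simp [hℓ, hℓ']) (by simp)

theorem IsWaringDecomp.sum {N : ℕ} {f : Fin N → MvPolynomial (Fin m) K}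
    (h : ∀ i, IsWaringDecomp (f i) d r) : IsWaringDecomp (∑ i, f i) d (r * N) := by
  choose c ℓ hℓ hf using fun i => isWaringDecomp_iff_exists_sum.1 (h i)
  have := isWaringDecomp_of_eq_sum (d := d) (F := ∑ i, f i) (fun p : Fin r × Fin N => c p.2 p.1)
    (fun p => ℓ p.2 p.1) (fun p => hℓ _ _) (by simp [hf, Fintype.sum_prod_type_right])
  simpa using this

end Decomp

section Upper

variable {K : Type*} [Field K] {m : ℕ} {L M Z : MvPolynomial (Fin m) K}

theorem isWaringDecomp_mul_mul_binary [CharZero K] (hL : L.IsHomogeneous 1)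
    (hM : M.IsHomogeneous 1) {i q u : K} (hi : i ^ 2 = -1) (hq : q ≠ 0) :
    IsWaringDecomp (L * M * (C (u * (1 - i)) * L ^ 2 + C (3 * q * u) * L * M +
      C (u * q ^ 2 * (1 + i)) * M ^ 2)) 4 2 := by
  refine IsWaringDecomp.of_C_mul (u := 4 * q) (by simpa using hq) ?_
  refine isWaringDecomp_of_eq_sum (ι := Fin 2) ![u, -u] (fun j => L + C (![q, i * q] j) * M)
    (fun j => hL.add (hM.C_mul _)) ?_
  have hi' : (C i : MvPolynomial (Fin m) K) ^ 2 = -1 := by rw [← C_pow, hi]; simp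
  simp [Fin.sum_univ_two, map_ofNat C]
  linear_combination C u * (6 * C q ^ 2 * L ^ 2 * M ^ 2 + 4 * C q ^ 3 * C i * L * M ^ 3 -
    C q ^ 4 * M ^ 4 * (1 - C i ^ 2)) * hi'

theorem isWaringDecomp_mul_mul_sq_add [IsAlgClosed K] [CharZero K] (hL : L.IsHomogeneous 1)
    (hM : M.IsHomogeneous 1) (hZ : Z.IsHomogeneous 1) {α β : K} (hα : α ≠ 0) (hβ : β ≠ 0) :
    IsWaringDecomp (L * M * (Z ^ 2 + C α * L ^ 2 + C β * M ^ 2)) 4 4 := by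
  obtain ⟨p, hp⟩ := IsAlgClosed.exists_pow_nat_eq (3 * α) zero_lt_two
  obtain ⟨q, hq⟩ := IsAlgClosed.exists_pow_nat_eq (3 * β) zero_lt_two
  have hp0 : p ≠ 0 := by rintro rfl; simp [hα] at hp
  have hq0 : q ≠ 0 := by rintro rfl; simp [hβ] at hq
  refine IsWaringDecomp.of_C_mul (u := 48 * p * q) (by simp [hp0, hq0]) ?_
  refine isWaringDecomp_of_eq_sum (ι := Fin 4) ![1, 1, -1, -1]
    (fun j => C p * L + C (![q, q, -q, -q] j) * M + C (![1, -1, 1, -1] j) * Z)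
    (fun j => ((hL.C_mul _).add (hM.C_mul _)).add (hZ.C_mul _)) ?_
  have hp' : (C p : MvPolynomial (Fin m) K) ^ 2 = 3 * C α := by
    rw [← C_pow, hp, C_mul, map_ofNat]
  have hq' : (C q : MvPolynomial (Fin m) K) ^ 2 = 3 * C β := by
    rw [← C_pow, hq, C_mul, map_ofNat]
  simp [Fin.sum_univ_four, map_ofNat C]
  linear_combination (-16 * C p * C q * L ^ 3 * M) * hp' - 16 * C p * C q * L * M ^ 3 * hq'

theorem isWaringDecomp_mul_mul_tangent [IsAlgClosed K] [CharZero K] (hL : L.IsHomogeneous 1)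
    (hM : M.IsHomogeneous 1) (hZ : Z.IsHomogeneous 1) {ρ : K} (hρ : ρ ≠ 0) :
    IsWaringDecomp (L * M * (C ρ * L ^ 2 + M * Z)) 4 6 := by
  obtain ⟨c, hc⟩ := IsAlgClosed.exists_pow_nat_eq (3 * ρ) zero_lt_two
  obtain ⟨ω, hω⟩ : ∃ ω : K, ω ^ 2 - ω + 1 = 0 := by
    obtain ⟨s, hs⟩ := IsAlgClosed.exists_pow_nat_eq (-3 : K) zero_lt_two
    exact ⟨(1 + s) / 2, by linear_combination hs / 4⟩
  have hc0 : c ≠ 0 := by rintro rfl; simp [hρ] at hc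
  refine IsWaringDecomp.of_C_mul (u := 72 * c) (by simp [hc0]) ?_
  refine isWaringDecomp_of_eq_sum (ι := Fin 6) ![1, -1, ω, -ω, ω ^ 2, -ω ^ 2]
    (fun j => C (![c, -c, c * ω, -(c * ω), c * ω ^ 2, -(c * ω ^ 2)] j) * L +
      C (![1, 1, ω ^ 2, ω ^ 2, ω ^ 4, ω ^ 4] j) * M + Z)
    (fun j => ((hL.C_mul _).add (hM.C_mul _)).add hZ) ?_
  have hc' : (C c : MvPolynomial (Fin m) K) ^ 2 = 3 * C ρ := by
    rw [← C_pow, hc, C_mul, map_ofNat]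
  have hω' : (C ω : MvPolynomial (Fin m) K) ^ 2 - C ω + 1 = 0 := by
    rw [← C_pow, ← C_1, ← C_sub, ← C_add, hω, C_0]
  have h2 : 1 + (C ω : MvPolynomial (Fin m) K) ^ 2 + C ω ^ 4 = 0 := by
    linear_combination (C ω ^ 2 + C ω + 1) * hω'
  have h3 : (C ω : MvPolynomial (Fin m) K) ^ 3 = -1 := by
    linear_combination (C ω + 1) * hω'
  have h6 : (C ω : MvPolynomial (Fin m) K) ^ 6 = 1 := by
    linear_combination (C ω ^ 3 - 1) * h3
  simp [Fin.sum_univ_six, map_ofNat C]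
  linear_combination (-24 * C c * L ^ 3 * M) * hc' -
    8 * C c * L * (Z ^ 3 + (3 * M * Z ^ 2 + C c ^ 2 * L ^ 2 * Z) + M ^ 3) * h2 -
    8 * C c * L * ((3 * M * Z ^ 2 + C c ^ 2 * L ^ 2 * Z) * C ω ^ 2 +
      (3 * M ^ 2 * Z + C c ^ 2 * L ^ 2 * M) * (2 + C ω ^ 6) +
      M ^ 3 * (C ω ^ 2 + C ω ^ 4 * (1 + C ω ^ 6))) * h6

end Upper

section Total

variable {K : Type*} [Field K] [IsAlgClosed K] [CharZero K] {m N : ℕ}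
  {L M W : MvPolynomial (Fin m) K} {Z : Fin N → MvPolynomial (Fin m) K}

theorem isWaringDecomp_mul_mul_sum_sq_add (hL : L.IsHomogeneous 1) (hM : M.IsHomogeneous 1)
    (hZ : ∀ i, (Z i).IsHomogeneous 1) (hN : N ≠ 0) (a c : K) {b : K} (hb : b ≠ 0) :
    IsWaringDecomp (L * M * (C a * L ^ 2 + C b * L * M + C c * M ^ 2 + ∑ i, Z i ^ 2)) 4
      (4 * N + 2) := by
  classical
  obtain ⟨i, hi⟩ := IsAlgClosed.exists_pow_nat_eq (-1 : K) zero_lt_two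
  have hi1 : 1 + i ≠ 0 := by
    intro h
    have : (2 : K) = 0 := by linear_combination (1 - i) * h + hi
    exact two_ne_zero this
  have hi2 : 1 - i ≠ 0 := by
    intro h
    have : (2 : K) = 0 := by linear_combination (1 + i) * h + hi
    exact two_ne_zero this
  obtain ⟨q, hq⟩ := Infinite.exists_notMem_finset
    ({0, b * (1 - i) / (3 * a), 3 * c / (b * (1 + i))} : Finset K)
  simp only [Finset.mem_insert, Finset.mem_singleton, not_or] at hq
  obtain ⟨hq0, hqa, hqc⟩ := hq
  have hN' : (N : K) ≠ 0 := Nat.cast_ne_zero.2 hN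
  set u := b / (3 * q) with hu
  have hα : a - u * (1 - i) ≠ 0 := by
    intro h
    rw [hu] at h
    field_simp at h
    rcases eq_or_ne a 0 with rfl | ha
    · exact mul_ne_zero hb hi2 (by linear_combination -h)
    · apply hqa
      field_simp
      linear_combination h
  have hβ : c - u * q ^ 2 * (1 + i) ≠ 0 := by
    intro h
    apply hqc
    rw [hu] at h
    field_simp at h ⊢
    linear_combination -h
  have key := (IsWaringDecomp.sum fun j => isWaringDecomp_mul_mul_sq_add hL hM (hZ j)
    (div_ne_zero hα hN') (div_ne_zero hβ hN')).add
    (isWaringDecomp_mul_mul_binary (u := u) hL hM hi hq0)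
  convert key using 1
  simp only [← Finset.mul_sum, Finset.sum_add_distrib, Finset.sum_const, Finset.card_univ,
    Fintype.card_fin, nsmul_eq_mul, ← mul_assoc, ← map_natCast C, ← C_mul]
  rw [div_mul_cancel₀ _ hN', div_mul_cancel₀ _ hN', show 3 * q * u = b by rw [hu]; field_simp]
  simp only [C_sub]
  ring

theorem isWaringDecomp_mul_mul_tangent_add_sum_sq (hL : L.IsHomogeneous 1)
    (hM : M.IsHomogeneous 1) (hW : W.IsHomogeneous 1) (hZ : ∀ i, (Z i).IsHomogeneous 1) {e : K}
    (he : e - 2 * N ≠ 0) :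
    IsWaringDecomp (L * M * (C e * L ^ 2 + M * W + ∑ i, Z i ^ 2)) 4 (4 * N + 6) := by
  have key := (IsWaringDecomp.sum fun j => isWaringDecomp_mul_mul_sq_add hL hM (hZ j)
    (two_ne_zero (α := K)) (two_ne_zero (α := K))).add
    (isWaringDecomp_mul_mul_tangent hL hM (hW.sub (hM.C_mul (2 * N))) he)
  convert key using 1
  simp only [← Finset.mul_sum, Finset.sum_add_distrib, Finset.sum_const, Finset.card_univ,
    Fintype.card_fin, nsmul_eq_mul, C_sub, C_mul, map_natCast, map_ofNat]
  ring

end Total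

theorem sumSqFrom_zero_eq (K : Type*) [CommSemiring K] (k : ℕ) : sumSqFrom K (k + 4) 0 =
    X 0 ^ 2 + X 1 ^ 2 + ∑ i : Fin (k + 2), X i.succ.succ ^ 2 := by
  simp [sumSqFrom, Fin.sum_univ_succ, add_assoc]

theorem sumSqFrom_one_eq (K : Type*) [CommSemiring K] (k : ℕ) : sumSqFrom K (k + 4) 1 =
    X 1 ^ 2 + ∑ i : Fin (k + 2), X i.succ.succ ^ 2 := by
  simp [sumSqFrom, Finset.sum_filter, Fin.sum_univ_succ]

theorem sumSqFrom_two_eq (K : Type*) [CommSemiring K] (k : ℕ) : sumSqFrom K (k + 4) 2 =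
    X 2 ^ 2 + ∑ i : Fin (k + 1), X i.succ.succ.succ ^ 2 := by
  simp [sumSqFrom, Finset.sum_filter, Fin.sum_univ_succ]

theorem sumSqFrom_three_eq (K : Type*) [CommSemiring K] (k : ℕ) : sumSqFrom K (k + 4) 3 =
    ∑ i : Fin (k + 1), X i.succ.succ.succ ^ 2 := by
  simp [sumSqFrom, Finset.sum_filter, Fin.sum_univ_succ]

section Bounds

variable {K : Type*} [Field K] {m d r s : ℕ} {F : MvPolynomial (Fin m) K}

theorem waringRank_bounds (hs : IsWaringDecomp F d s)
    (hr : ∀ t, IsWaringDecomp F d t → r ≤ t) : r ≤ waringRank F d ∧ waringRank F d ≤ s :=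
  ⟨hr _ (Nat.sInf_mem (s := {t | IsWaringDecomp F d t}) ⟨s, hs⟩), Nat.sInf_le hs⟩

variable [IsAlgClosed K] [CharZero K] {k : ℕ}

theorem waringRank_tangent_bounds {e : K} (he : e - 2 * (k + 1 : ℕ) ≠ 0) {F}
    (hF : F = X 0 * X 1 * (C e * X 0 ^ 2 + X 1 * X 2 +
      ∑ i : Fin (k + 1), X i.succ.succ.succ ^ 2 : MvPolynomial (Fin (k + 4)) K)) :
    4 * (k + 2) ≤ waringRank F 4 ∧ waringRank F 4 ≤ 4 * (k + 2) + 2 := by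
  subst hF
  exact waringRank_bounds (isWaringDecomp_mul_mul_tangent_add_sum_sq (isHomogeneous_X _ _)
    (isHomogeneous_X _ _) (isHomogeneous_X _ _) (fun _ => isHomogeneous_X _ _) he)
    fun _ h => h.le_of_tangent

theorem waringRank_mul_mul_bounds {F L M : MvPolynomial (Fin (k + 4)) K}
    {Z : Fin (k + 2) → MvPolynomial (Fin (k + 4)) K} (hL : L.IsHomogeneous 1)
    (hM : M.IsHomogeneous 1) (hZ : ∀ i, (Z i).IsHomogeneous 1) (a c : K) {b : K} (hb : b ≠ 0)
    (hF : F = L * M * (C a * L ^ 2 + C b * L * M + C c * M ^ 2 + ∑ i, Z i ^ 2))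
    {g : Fin (k + 4) → MvPolynomial (Fin (k + 4)) K} (hg : ∀ i, (g i).IsHomogeneous 1)
    (hgL : aeval g L = X 0) (hgM : aeval g M = X 1) (hgZ : ∀ i, aeval g (Z i) = X i.succ.succ) :
    4 * (k + 2) ≤ waringRank F 4 ∧ waringRank F 4 ≤ 4 * (k + 2) + 2 := by
  subst hF
  have hup := isWaringDecomp_mul_mul_sum_sq_add hL hM hZ (Nat.succ_ne_zero _) a c hb
  refine waringRank_bounds hup fun r h => ?_
  have h' := h.aeval hg
  apply IsWaringDecomp.le_of_mul_sumSq (a := a) (b := b) (c := c)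
  simp only [map_mul, map_add, map_pow, map_sum, hgL, hgM, hgZ, aeval_C, algebraMap_eq] at h'
  exact h'

end Bounds

/-- For `n ≥ 3`, each of the quartics `F₅`, `F₇`, `F_{8,λ}` (λ ≠ 0),
`F₉` and `F_{10,λ}` satisfies `4(n−1) ≤ rk(F) ≤ 4(n−1) + 2`. -/
theorem stmt18 (K : Type*) [Field K] [IsAlgClosed K] [CharZero K] (n : ℕ) (hn : 3 ≤ n)
    (F : MvPolynomial (Fin (n + 1)) K)
    (hF : F = X 0 * X 1 * (X 1 * X 2 + sumSqFrom K (n + 1) 3) ∨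
      F = X 0 * (X 0 + X 1) * sumSqFrom K (n + 1) 1 ∨
      (∃ lam : K, lam ≠ 0 ∧
        F = X 0 * (C lam * X 0 + X 1) * sumSqFrom K (n + 1) 0) ∨
      F = X 0 * X 1 * ((X 0) ^ 2 + X 1 * X 2 + sumSqFrom K (n + 1) 3) ∨
      (∃ lam : K, F = X 0 * (C (-lam ^ 2) * X 0 + X 1 + C lam * X 2) *
        (X 0 * X 1 + sumSqFrom K (n + 1) 2))) :
    4 * (n - 1) ≤ waringRank F 4 ∧ waringRank F 4 ≤ 4 * (n - 1) + 2 := by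
  obtain ⟨k, rfl⟩ := Nat.exists_eq_add_of_le' hn
  change 4 * (k + 2) ≤ waringRank F 4 ∧ waringRank F 4 ≤ 4 * (k + 2) + 2
  have hX (i : Fin (k + 4)) : (X i : MvPolynomial (Fin (k + 4)) K).IsHomogeneous 1 :=
    isHomogeneous_X _ _
  have h1 (j : Fin (k + 2)) : j.succ.succ ≠ (1 : Fin (k + 4)) := Fin.succ_succ_ne_one j
  have h2 (j : Fin (k + 1)) : j.succ.succ.succ ≠ (2 : Fin (k + 4)) := by
    rw [Ne, Fin.ext_iff, Fin.val_two]; simp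
  have h01 : (0 : Fin (k + 4)) ≠ 1 := zero_ne_one
  have h02 : (0 : Fin (k + 4)) ≠ 2 := by rw [Ne, Fin.ext_iff, Fin.val_two]; simp
  have h12 : (1 : Fin (k + 4)) ≠ 2 := by rw [Ne, Fin.ext_iff, Fin.val_two]; simp
  obtain rfl | rfl | ⟨lam, hlam, rfl⟩ | rfl | ⟨lam, rfl⟩ := hF
  · refine waringRank_tangent_bounds (e := 0) ?_ ?_
    · rw [zero_sub, neg_ne_zero]
      exact mul_ne_zero two_ne_zero (Nat.cast_ne_zero.2 k.succ_ne_zero)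
    · rw [sumSqFrom_three_eq, C_0]
      ring
  · refine waringRank_mul_mul_bounds (hX 0) ((hX 0).add (hX 1)) (fun i => hX i.succ.succ) 1 1
      (b := -2) (by simp) ?_ (g := Function.update X 1 (X 1 - X 0)) ?_ ?_ ?_ ?_
    · rw [sumSqFrom_one_eq]
      simp only [C_neg, C_1, map_ofNat]
      ring
    · rw [Function.forall_update_iff X fun _ f => f.IsHomogeneous 1]
      exact ⟨(hX 1).sub (hX 0), fun i _ => hX i⟩
    · simp [h01]
    · simp [h01]
    · simp [h1]
  · refine waringRank_mul_mul_bounds (hX 0) (((hX 0).C_mul lam).add (hX 1))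
      (fun i => hX i.succ.succ) (1 + lam ^ 2) 1 (b := -2 * lam) (by simp [hlam]) ?_
      (g := Function.update X 1 (X 1 - C lam * X 0)) ?_ ?_ ?_ ?_
    · rw [sumSqFrom_zero_eq]
      simp only [C_neg, C_add, C_mul, C_pow, C_1, map_ofNat]
      ring
    · rw [Function.forall_update_iff X fun _ f => f.IsHomogeneous 1]
      exact ⟨(hX 1).sub ((hX 0).C_mul lam), fun i _ => hX i⟩
    · simp [h01]
    · simp [h01, algebraMap_eq]
    · simp [h1]
  · refine waringRank_tangent_bounds (e := 1) ?_ ?_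
    · rw [sub_ne_zero]
      exact_mod_cast (by omega : 1 ≠ 2 * (k + 1))
    · rw [sumSqFrom_three_eq, C_1]
      ring
  · obtain ⟨μ, rfl⟩ : ∃ μ, lam = 2 * μ := ⟨lam / 2, (mul_div_cancel₀ _ two_ne_zero).symm⟩
    refine waringRank_mul_mul_bounds (hX 0)
      ((((hX 0).C_mul (-(2 * μ) ^ 2)).add (hX 1)).add ((hX 2).C_mul (2 * μ)))
      (Z := Fin.cons (X 2 - C μ * X 0) fun i => X i.succ.succ.succ) ?_
      (3 * μ ^ 2) 0 (b := 1) one_ne_zero ?_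
      (g := Function.update (Function.update X 1 (X 1 + C (2 * μ ^ 2) * X 0 - C (2 * μ) * X 2))
        2 (X 2 + C μ * X 0)) ?_ ?_ ?_ ?_
    · exact Fin.cases ((hX 2).sub ((hX 0).C_mul _)) fun i => hX i.succ.succ.succ
    · rw [sumSqFrom_two_eq, Fin.sum_univ_succ (n := k + 1)]
      simp only [Fin.cons_zero, Fin.cons_succ, C_neg, C_mul, C_pow, C_0, C_1, map_ofNat]
      ring
    · refine (Function.forall_update_iff _ fun _ f => IsHomogeneous f 1).2
        ⟨(hX 2).add ((hX 0).C_mul _), fun i _ => ?_⟩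
      exact (Function.forall_update_iff X fun _ f => IsHomogeneous f 1).2
        ⟨((hX 1).add ((hX 0).C_mul _)).sub ((hX 2).C_mul _), fun i _ => hX i⟩ i
    · simp [h01, h02]
    · simp only [map_add, map_mul, aeval_X, aeval_C, algebraMap_eq, Function.update_self,
        Function.update_of_ne h01, Function.update_of_ne h02, Function.update_of_ne h12,
        map_neg, map_pow, map_ofNat]
      ring
    · refine Fin.cases ?_ fun i => ?_
      · simp [h02, h01, algebraMap_eq]
      · simp [h1, h2]
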